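/- Let x, t, s be elements of A satisfying x·s = q²·s·x, s·t = q²·t·s and x·t = q·t·x + λ·s, and suppose q is a primitive n-th root of unity with n odd. Then (x + t)^n = x^n + t^n. -/

import Mathlib

open Finset in
/-- The `q`-integer `1 + q + ⋯ + q ^ (m - 1)`. -/
def qInt {k : Type*} [Semiring k] (q : k) (m : ℕ) : k := ∑ r ∈ range m, q ^ r

theorem qInt_zero {k : Type*} [Semiring k] (q : k) : qInt q 0 = 0 := by simp [qInt]

theorem qInt_succ {k : Type*} [CommSemiring k] (q : k) (m : ℕ) :
    qInt q (m + 1) = 1 + q * qInt q m := by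
  simp [qInt, Finset.sum_range_succ', Finset.mul_sum, pow_succ', add_comm]

theorem qInt_add {k : Type*} [CommSemiring k] (q : k) (a b : ℕ) :
    qInt q (a + b) = qInt q a + q ^ a * qInt q b := by
  simp [qInt, Finset.sum_range_add, Finset.mul_sum, pow_add]

theorem qInt_mul_sub_one {k : Type*} [CommRing k] (q : k) (m : ℕ) :
    qInt q m * (q - 1) = q ^ m - 1 := geom_sum_mul q m

/-- The `q`-factorial. -/
def qFact {k : Type*} [CommSemiring k] (q : k) : ℕ → k
  | 0 => 1
  | m + 1 => qInt q (m + 1) * qFact q m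

/-- The product of the `q`-integers of the even numbers `2, 4, …, 2 * j`. -/
def qEvenFact {k : Type*} [CommSemiring k] (q : k) : ℕ → k
  | 0 => 1
  | j + 1 => qInt q (2 * (j + 1)) * qEvenFact q j

theorem qFact_ne_zero {k : Type*} [Field k] {q : k} {m : ℕ}
    (h : ∀ r, 1 ≤ r → r ≤ m → qInt q r ≠ 0) : qFact q m ≠ 0 := by
  induction m with
  | zero => simp [qFact]
  | succ m ih =>
    exact mul_ne_zero (h _ (by omega) le_rfl) (ih fun r h1 h2 => h r h1 (by omega))

theorem qEvenFact_ne_zero {k : Type*} [Field k] {q : k} {j : ℕ}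
    (h : ∀ r, 1 ≤ r → r ≤ 2 * j → qInt q r ≠ 0) : qEvenFact q j ≠ 0 := by
  induction j with
  | zero => simp [qEvenFact]
  | succ j ih =>
    exact mul_ne_zero (h _ (by omega) le_rfl) (ih fun r h1 h2 => h r h1 (by omega))

/-- Left multiplication by `x + t` in terms of the ordered monomials `t ^ i * s ^ j * x ^ l`,
where `(i, j, l)` stands for such a monomial with `s` scaled by `lam`. -/
noncomputable def orderedMul {k : Type*} [CommSemiring k] (q : k) :
    (ℕ × ℕ × ℕ →₀ k) →ₗ[k] (ℕ × ℕ × ℕ →₀ k) :=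
  Finsupp.linearCombination k fun p =>
    Finsupp.single (p.1 + 1, p.2.1, p.2.2) 1 +
    Finsupp.single (p.1, p.2.1, p.2.2 + 1) (q ^ (p.1 + 2 * p.2.1)) +
    Finsupp.single (p.1 - 1, p.2.1 + 1, p.2.2) (q ^ (p.1 - 1) * qInt q p.1)

theorem orderedMul_apply {k : Type*} [CommSemiring k] (q : k) (c : ℕ × ℕ × ℕ →₀ k)
    (i j l : ℕ) :
    orderedMul q c (i, j, l) =
      (if i = 0 then 0 else c (i - 1, j, l)) +
      (if l = 0 then 0 else q ^ (i + 2 * j) * c (i, j, l - 1)) +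
      (if j = 0 then 0 else q ^ i * qInt q (i + 1) * c (i + 1, j - 1, l)) := by
  induction c using Finsupp.induction_linear with
  | zero => simp
  | add f g hf hg =>
    rw [map_add, Finsupp.add_apply, hf, hg]
    simp only [Finsupp.add_apply]
    split_ifs <;> ring
  | single p r =>
    obtain ⟨a, b, d⟩ := p
    simp only [orderedMul, Finsupp.linearCombination_single, Finsupp.smul_apply,
      Finsupp.add_apply, smul_eq_mul, mul_add, Finsupp.single_apply, Prod.mk.injEq]
    congr 1
    · congr 1
      · by_cases hi : i = 0
        · simp [hi]
        · have : a + 1 = i ↔ a = i - 1 := by omega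
          simp [hi, this]
      · by_cases hl : l = 0
        · simp [hl]
        · have : d + 1 = l ↔ d = l - 1 := by omega
          simp only [hl, this, if_false]
          split_ifs with h
          · rw [h.1, h.2.1, mul_comm]
          · simp
    · by_cases hj : j = 0
      · simp [hj]
      · rcases a with _ | a
        · simp [qInt_zero]
        · have : b + 1 = j ↔ b = j - 1 := by omega
          simp only [hj, this, if_false, Nat.add_sub_cancel, Nat.add_right_cancel_iff]
          split_ifs with h
          · rw [h.1, mul_comm]
          · simp

/-- The coefficients of `(x + t) ^ m` in terms of ordered monomials. -/
noncomputable def orderedPow {k : Type*} [CommSemiring k] (q : k) : ℕ → ℕ × ℕ × ℕ →₀ k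
  | 0 => Finsupp.single (0, 0, 0) 1
  | m + 1 => orderedMul q (orderedPow q m)

theorem orderedPow_eq_zero {k : Type*} [CommSemiring k] (q : k) {m i j l : ℕ}
    (h : i + 2 * j + l ≠ m) : orderedPow q m (i, j, l) = 0 := by
  induction m generalizing i j l with
  | zero =>
    rw [orderedPow, Finsupp.single_apply, if_neg]
    simp only [Prod.mk.injEq]
    omega
  | succ m ih =>
    rw [orderedPow, orderedMul_apply]
    have h1 : i ≠ 0 → orderedPow q m (i - 1, j, l) = 0 := fun _ => ih (by omega)
    have h2 : l ≠ 0 → orderedPow q m (i, j, l - 1) = 0 := fun _ => ih (by omega)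
    have h3 : j ≠ 0 → orderedPow q m (i + 1, j - 1, l) = 0 := fun _ => ih (by omega)
    split_ifs <;> simp_all

theorem orderedPow_left {k : Type*} [CommSemiring k] (q : k) (m : ℕ) :
    orderedPow q m (m, 0, 0) = 1 := by
  induction m with
  | zero => simp [orderedPow]
  | succ m ih => simp [orderedPow, orderedMul_apply, ih]

theorem orderedPow_right {k : Type*} [CommSemiring k] (q : k) (m : ℕ) :
    orderedPow q m (0, 0, m) = 1 := by
  induction m with
  | zero => simp [orderedPow]
  | succ m ih => simp [orderedPow, orderedMul_apply, ih]

theorem mul_orderedPow {k : Type*} [CommSemiring k] (q : k) {m i j l : ℕ}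
    (h : i + 2 * j + l = m) :
    qFact q i * qEvenFact q j * qFact q l * orderedPow q m (i, j, l) = qFact q m := by
  induction m generalizing i j l with
  | zero =>
    obtain ⟨rfl, rfl, rfl⟩ : i = 0 ∧ j = 0 ∧ l = 0 := by omega
    simp [orderedPow, qFact, qEvenFact]
  | succ m ih =>
    have h1 : qFact q i * qEvenFact q j * qFact q l *
        (if i = 0 then 0 else orderedPow q m (i - 1, j, l)) = qInt q i * qFact q m := by
      rcases i with _ | i
      · simp [qInt_zero]
      · rw [← ih (i := i) (j := j) (l := l) (by omega)]
        simp only [Nat.add_sub_cancel, qFact, Nat.succ_ne_zero, if_false]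
        ring
    have h2 : qFact q i * qEvenFact q j * qFact q l *
        (if l = 0 then 0 else q ^ (i + 2 * j) * orderedPow q m (i, j, l - 1)) =
          q ^ (i + 2 * j) * qInt q l * qFact q m := by
      rcases l with _ | l
      · simp [qInt_zero]
      · rw [← ih (i := i) (j := j) (l := l) (by omega)]
        simp only [Nat.add_sub_cancel, qFact, Nat.succ_ne_zero, if_false]
        ring
    have h3 : qFact q i * qEvenFact q j * qFact q l *
        (if j = 0 then 0 else q ^ i * qInt q (i + 1) * orderedPow q m (i + 1, j - 1, l)) =
          q ^ i * qInt q (2 * j) * qFact q m := by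
      rcases j with _ | j
      · simp [qInt_zero]
      · rw [← ih (i := i + 1) (j := j) (l := l) (by omega)]
        simp only [Nat.add_sub_cancel, qFact, qEvenFact, Nat.succ_ne_zero, if_false]
        ring
    rw [orderedPow, orderedMul_apply, mul_add, mul_add, h1, h2, h3, qFact, ← h, qInt_add,
      qInt_add]
    ring

section Algebra

variable {k A : Type*} [CommRing k] [Ring A] [Algebra k A] {q lam : k} {x t s : A}

theorem mul_pow_of_qComm (hst : s * t = (q ^ 2) • (t * s))
    (hxt : x * t = q • (t * x) + lam • s) (i : ℕ) :
    x * t ^ i = q ^ i • (t ^ i * x) + (lam * (q ^ (i - 1) * qInt q i)) • (t ^ (i - 1) * s) := by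
  induction i with
  | zero => simp [qInt_zero]
  | succ i ih =>
    have hs : (lam * (q ^ (i - 1) * qInt q i)) • (t ^ (i - 1) * s * t) =
        (lam * (q ^ (i + 1) * qInt q i)) • (t ^ i * s) := by
      rcases i with _ | i
      · simp [qInt_zero]
      · rw [mul_assoc, hst, mul_smul_comm, smul_smul, Nat.add_sub_cancel,
          ← mul_assoc (t ^ i), ← pow_succ]
        congr 1
        ring
    rw [pow_succ t, ← mul_assoc, ih, add_mul, smul_mul_assoc, smul_mul_assoc, hs, mul_assoc,
      hxt, mul_add, mul_smul_comm, mul_smul_comm, ← mul_assoc, ← pow_succ, smul_add, smul_smul,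
      smul_smul, add_assoc, ← add_smul, Nat.add_sub_cancel, qInt_succ]
    congr 2 <;> ring

theorem mul_pow_of_qSqComm (hxs : x * s = (q ^ 2) • (s * x)) (j : ℕ) :
    x * s ^ j = q ^ (2 * j) • (s ^ j * x) := by
  induction j with
  | zero => simp
  | succ j ih =>
    rw [pow_succ, ← mul_assoc, ih, smul_mul_assoc, mul_assoc, hxs, mul_smul_comm, smul_smul,
      mul_assoc]
    congr 1
    ring

/-- Evaluation of a combination of ordered monomials in the algebra. -/
noncomputable def orderedEval (lam : k) (x t s : A) : (ℕ × ℕ × ℕ →₀ k) →ₗ[k] A :=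
  Finsupp.linearCombination k fun p => lam ^ p.2.1 • (t ^ p.1 * s ^ p.2.1 * x ^ p.2.2)

theorem orderedEval_orderedMul (hxs : x * s = (q ^ 2) • (s * x))
    (hst : s * t = (q ^ 2) • (t * s)) (hxt : x * t = q • (t * x) + lam • s)
    (c : ℕ × ℕ × ℕ →₀ k) :
    orderedEval lam x t s (orderedMul q c) = (x + t) * orderedEval lam x t s c := by
  induction c using Finsupp.induction_linear with
  | zero => simp
  | add f g hf hg => rw [map_add, map_add, hf, hg, map_add, mul_add]
  | single p r =>
    obtain ⟨i, j, l⟩ := p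
    have hx : x * (t ^ i * s ^ j * x ^ l) = q ^ (i + 2 * j) • (t ^ i * s ^ j * x ^ (l + 1)) +
        (lam * (q ^ (i - 1) * qInt q i)) • (t ^ (i - 1) * s ^ (j + 1) * x ^ l) := by
      rw [← mul_assoc, ← mul_assoc, mul_pow_of_qComm hst hxt, add_mul, add_mul,
        smul_mul_assoc, smul_mul_assoc, smul_mul_assoc, smul_mul_assoc, mul_assoc (t ^ i) x,
        mul_pow_of_qSqComm hxs, mul_smul_comm, smul_mul_assoc, smul_smul, ← pow_add,
        pow_succ' x, pow_succ' s]
      simp only [mul_assoc]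
    simp only [orderedMul, orderedEval, Finsupp.linearCombination_single, map_smul, map_add,
      mul_smul_comm, add_mul x t, hx, pow_succ' t, mul_assoc t]
    module

theorem orderedEval_orderedPow (hxs : x * s = (q ^ 2) • (s * x))
    (hst : s * t = (q ^ 2) • (t * s)) (hxt : x * t = q • (t * x) + lam • s) (m : ℕ) :
    orderedEval lam x t s (orderedPow q m) = (x + t) ^ m := by
  induction m with
  | zero => simp [orderedPow, orderedEval]
  | succ m ih => rw [orderedPow, orderedEval_orderedMul hxs hst hxt, ih, pow_succ']

end Algebra

theorem orderedPow_of_primitive {k : Type*} [Field k] {q : k} {n : ℕ} (hodd : Odd n)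
    (hn : n ≠ 1) (hq1 : q ^ n = 1) (hq2 : ∀ m : ℕ, 1 ≤ m → m < n → q ^ m ≠ 1) :
    orderedPow q n = Finsupp.single (0, 0, n) 1 + Finsupp.single (n, 0, 0) 1 := by
  have hpos : 0 < n := hodd.pos
  have hq : q - 1 ≠ 0 := sub_ne_zero.2 (by simpa using hq2 1 le_rfl (by omega))
  have hne : ∀ r, 1 ≤ r → r < n → qInt q r ≠ 0 := fun r h1 h2 h =>
    hq2 r h1 h2 (sub_eq_zero.1 (by rw [← qInt_mul_sub_one, h, zero_mul]))
  have hzero : qInt q n = 0 := by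
    have := qInt_mul_sub_one q n
    rw [hq1, sub_self] at this
    exact (mul_eq_zero.1 this).resolve_right hq
  have hfact : qFact q n = 0 := by
    obtain ⟨m, rfl⟩ := Nat.exists_eq_succ_of_ne_zero hpos.ne'
    rw [qFact, hzero, zero_mul]
  ext ⟨i, j, l⟩
  rw [Finsupp.add_apply, Finsupp.single_apply, Finsupp.single_apply]
  simp only [Prod.mk.injEq]
  by_cases hd : i + 2 * j + l = n
  · by_cases hi : i = n
    · obtain ⟨rfl, rfl⟩ : j = 0 ∧ l = 0 := by omega
      rw [hi, orderedPow_left, if_neg (by omega), if_pos (by simp), zero_add]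
    by_cases hl : l = n
    · obtain ⟨rfl, rfl⟩ : i = 0 ∧ j = 0 := by omega
      rw [hl, orderedPow_right, if_pos (by simp), if_neg (by omega), add_zero]
    rw [if_neg (by omega), if_neg (by omega), add_zero]
    have hj : 2 * j < n := by
      obtain ⟨a, ha⟩ := hodd
      omega
    have h := mul_orderedPow q hd
    rw [hfact] at h
    refine (mul_eq_zero.1 h).resolve_left (mul_ne_zero (mul_ne_zero ?_ ?_) ?_)
    · exact qFact_ne_zero fun r h1 h2 => hne r h1 (by omega)
    · exact qEvenFact_ne_zero fun r h1 h2 => hne r h1 (by omega)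
    · exact qFact_ne_zero fun r h1 h2 => hne r h1 (by omega)
  · rw [orderedPow_eq_zero q hd, if_neg (by omega), if_neg (by omega), add_zero]

theorem x_add_t_pow_n {k A : Type*} [Field k] [Ring A] [Algebra k A]
    (q lam : k) (n : ℕ) (hodd : Odd n)
    (hq1 : q ^ n = 1) (hq2 : ∀ m : ℕ, 1 ≤ m → m < n → q ^ m ≠ 1)
    (x t s : A)
    (hxs : x * s = (q ^ 2) • (s * x)) (hst : s * t = (q ^ 2) • (t * s))
    (hxt : x * t = q • (t * x) + lam • s) :
    (x + t) ^ n = x ^ n + t ^ n := by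
  rcases eq_or_ne n 1 with rfl | hn
  · simp
  · rw [← orderedEval_orderedPow hxs hst hxt, orderedPow_of_primitive hodd hn hq1 hq2]
    simp [orderedEval]
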